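/- arXiv:1910.03140 — 4 statements merged into one kernel-verified Lean document; each statement's English description precedes it below -/
import Mathlib

section
/- Let N ≥ 1 and let X₁, X₂, X₃, X₄ be N×N complex Hermitian matrices, and set U_j = exp(i X_j) (so each U_j is unitary). Then the Frobenius norm of the plaquette variable U₁U₂U₃*U₄* minus the identity satisfies the global quadratic bound ‖U₁U₂U₃*U₄* − 1‖²_F ≤ 4N · (‖X₁‖²_F + ‖X₂‖²_F + ‖X₃‖²_F + ‖X₄‖²_F), where * denotes the conjugate transpose. -/
open Matrix
/-- The squared Frobenius (Hilbert–Schmidt) norm of a complex matrix: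
`‖A‖²_F = Tr(AᴴA)` (which is a real number). -/
noncomputable def frobSq {N : ℕ} (A : Matrix (Fin N) (Fin N) ℂ) : ℝ :=
  (Matrix.trace (Aᴴ * A)).re

theorem frobSq_eq_sum {N : ℕ} (A : Matrix (Fin N) (Fin N) ℂ) :
    frobSq A = ∑ i, ∑ j, ‖A j i‖ ^ 2 := by
  unfold frobSq
  simp only [Matrix.trace, Matrix.diag, Matrix.mul_apply, Matrix.conjTranspose_apply,
    Complex.re_sum]
  refine Finset.sum_congr rfl fun i _ => Finset.sum_congr rfl fun j _ => ?_
  rw [← Complex.normSq_eq_norm_sq, Complex.normSq_apply]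
  simp

theorem frobSq_nonneg {N : ℕ} (A : Matrix (Fin N) (Fin N) ℂ) : 0 ≤ frobSq A := by
  rw [frobSq_eq_sum]; positivity

theorem frobSq_conjTranspose {N : ℕ} (A : Matrix (Fin N) (Fin N) ℂ) :
    frobSq Aᴴ = frobSq A := by
  unfold frobSq
  rw [Matrix.conjTranspose_conjTranspose, Matrix.trace_mul_comm]

theorem frobSq_unitary_mul {N : ℕ} (V A : Matrix (Fin N) (Fin N) ℂ) (hV : Vᴴ * V = 1) :
    frobSq (V * A) = frobSq A := by
  unfold frobSq
  rw [Matrix.conjTranspose_mul, Matrix.mul_assoc, ← Matrix.mul_assoc Vᴴ, hV, Matrix.one_mul]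

theorem frobSq_mul_conjTranspose {N : ℕ} (V A : Matrix (Fin N) (Fin N) ℂ) (hV : Vᴴ * V = 1) :
    frobSq (A * Vᴴ) = frobSq A := by
  rw [← frobSq_conjTranspose, Matrix.conjTranspose_mul, Matrix.conjTranspose_conjTranspose,
    frobSq_unitary_mul _ _ hV, frobSq_conjTranspose]

theorem frobSq_add4 {N : ℕ} (A B C D : Matrix (Fin N) (Fin N) ℂ) :
    frobSq (A + B + C + D) ≤ 4 * (frobSq A + frobSq B + frobSq C + frobSq D) := by
  simp only [frobSq_eq_sum, ← Finset.sum_add_distrib, Finset.mul_sum]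
  refine Finset.sum_le_sum fun i _ => Finset.sum_le_sum fun j _ => ?_
  simp only [Matrix.add_apply]
  generalize A j i = a
  generalize B j i = b
  generalize C j i = c
  generalize D j i = d
  have h : ‖a + b + c + d‖ ≤ ‖a‖ + ‖b‖ + ‖c‖ + ‖d‖ := norm_add₄_le
  have h2 := pow_le_pow_left₀ (norm_nonneg _) h 2
  nlinarith [sq_nonneg (‖a‖ - ‖b‖), sq_nonneg (‖a‖ - ‖c‖), sq_nonneg (‖a‖ - ‖d‖),
    sq_nonneg (‖b‖ - ‖c‖), sq_nonneg (‖b‖ - ‖d‖), sq_nonneg (‖c‖ - ‖d‖)]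

theorem exp_unitary {N : ℕ} (X : Matrix (Fin N) (Fin N) ℂ) (h : X.IsHermitian) :
    (NormedSpace.exp (Complex.I • X))ᴴ * NormedSpace.exp (Complex.I • X) = 1 := by
  have h' : (Complex.I • X)ᴴ = -(Complex.I • X) := by
    rw [Matrix.conjTranspose_smul, h.eq]; simp
  rw [← Matrix.exp_conjTranspose, h', ← Matrix.exp_add_of_commute]
  · simp
  · exact (Commute.refl _).neg_left

theorem frobSq_diagonal_le {N : ℕ} (d : Fin N → ℝ) :
    frobSq (NormedSpace.exp (Complex.I • Matrix.diagonal (fun i => (d i : ℂ))) - 1)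
      ≤ frobSq (Matrix.diagonal (fun i => (d i : ℂ))) := by
  rw [← Matrix.diagonal_smul, Matrix.exp_diagonal, ← Matrix.diagonal_one, Matrix.diagonal_sub,
    frobSq_eq_sum, frobSq_eq_sum]
  refine Finset.sum_le_sum fun i _ => Finset.sum_le_sum fun j _ => ?_
  by_cases hij : j = i
  · subst hij
    simp only [Matrix.diagonal_apply_eq, Pi.coe_exp, Pi.smul_apply, smul_eq_mul,
      ← Complex.exp_eq_exp_ℂ]
    refine pow_le_pow_left₀ (norm_nonneg _) ?_ 2
    simpa using Real.norm_exp_I_mul_ofReal_sub_one_le (x := d j)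
  · simp [Matrix.diagonal_apply_ne _ hij]

theorem frobSq_exp_sub_one_le {N : ℕ} (X : Matrix (Fin N) (Fin N) ℂ) (h : X.IsHermitian) :
    frobSq (NormedSpace.exp (Complex.I • X) - 1) ≤ frobSq X := by
  obtain ⟨V, d, hV, hX⟩ : ∃ (V : Matrix (Fin N) (Fin N) ℂ) (d : Fin N → ℝ),
      Vᴴ * V = 1 ∧ X = V * Matrix.diagonal (fun i => (d i : ℂ)) * Vᴴ := by
    refine ⟨h.eigenvectorUnitary, h.eigenvalues, ?_, ?_⟩
    · exact Unitary.coe_star_mul_self h.eigenvectorUnitary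
    · exact h.spectral_theorem
  have hV' : V * Vᴴ = 1 := mul_eq_one_comm.mp hV
  have hinv : V⁻¹ = Vᴴ := Matrix.inv_eq_left_inv hV
  have hu : IsUnit V := ⟨⟨V, Vᴴ, hV', hV⟩, rfl⟩
  have e : NormedSpace.exp (Complex.I • X) - 1 =
      V * (NormedSpace.exp (Complex.I • Matrix.diagonal (fun i => (d i : ℂ))) - 1) * Vᴴ := by
    have := Matrix.exp_conj V (Complex.I • Matrix.diagonal (fun i => (d i : ℂ))) hu
    rw [hinv] at this
    rw [mul_sub, sub_mul, ← this, mul_one, hV', hX, Matrix.mul_smul, Matrix.smul_mul]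
  rw [e, hX, frobSq_mul_conjTranspose _ _ hV, frobSq_mul_conjTranspose _ _ hV,
    frobSq_unitary_mul _ _ hV, frobSq_unitary_mul _ _ hV]
  exact frobSq_diagonal_le d


/-- the paper's Lemma 2, four retained bonds: for Hermitian `X₁,…,X₄` and
`U_j = exp(i X_j)`, the plaquette variable satisfies the global quadratic bound
`‖U₁U₂U₃ᴴU₄ᴴ − 1‖²_F ≤ 4N (‖X₁‖²_F + ‖X₂‖²_F + ‖X₃‖²_F + ‖X₄‖²_F)`. -/
theorem plaquette_global_quadratic_bound (N : ℕ) (hN : 1 ≤ N)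
    (X₁ X₂ X₃ X₄ : Matrix (Fin N) (Fin N) ℂ)
    (h₁ : X₁.IsHermitian) (h₂ : X₂.IsHermitian) (h₃ : X₃.IsHermitian) (h₄ : X₄.IsHermitian) :
    frobSq (NormedSpace.exp (Complex.I • X₁) * NormedSpace.exp (Complex.I • X₂) *
        (NormedSpace.exp (Complex.I • X₃))ᴴ * (NormedSpace.exp (Complex.I • X₄))ᴴ - 1)
      ≤ 4 * N * (frobSq X₁ + frobSq X₂ + frobSq X₃ + frobSq X₄) := by
  have u₁ := exp_unitary X₁ h₁
  have u₂ := exp_unitary X₂ h₂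
  have u₃ := exp_unitary X₃ h₃
  have b₁ := frobSq_exp_sub_one_le X₁ h₁
  have b₂ := frobSq_exp_sub_one_le X₂ h₂
  have b₃ := frobSq_exp_sub_one_le X₃ h₃
  have b₄ := frobSq_exp_sub_one_le X₄ h₄
  have n₁ := frobSq_nonneg X₁
  have n₂ := frobSq_nonneg X₂
  have n₃ := frobSq_nonneg X₃
  have n₄ := frobSq_nonneg X₄
  generalize NormedSpace.exp (Complex.I • X₁) = A at *
  generalize NormedSpace.exp (Complex.I • X₂) = B at *
  generalize NormedSpace.exp (Complex.I • X₃) = C at *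
  generalize NormedSpace.exp (Complex.I • X₄) = D at *
  have u₃' : Cᴴᴴ * Cᴴ = 1 := by
    rw [Matrix.conjTranspose_conjTranspose]; exact mul_eq_one_comm.mp u₃
  have e : A * B * Cᴴ * Dᴴ - 1 =
      A * (B * (Cᴴ * (D - 1)ᴴ)) + A * (B * (C - 1)ᴴ) + A * (B - 1) + (A - 1) := by
    simp only [Matrix.conjTranspose_sub, Matrix.conjTranspose_one]
    noncomm_ring
  have key := frobSq_add4 (A * (B * (Cᴴ * (D - 1)ᴴ))) (A * (B * (C - 1)ᴴ)) (A * (B - 1)) (A - 1)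
  rw [← e, frobSq_unitary_mul _ _ u₁, frobSq_unitary_mul _ _ u₁, frobSq_unitary_mul _ _ u₁,
    frobSq_unitary_mul _ _ u₂, frobSq_unitary_mul _ _ u₂, frobSq_unitary_mul _ _ u₃',
    frobSq_conjTranspose, frobSq_conjTranspose] at key
  have hN' : (1 : ℝ) ≤ N := by exact_mod_cast hN
  have hs : 0 ≤ frobSq X₁ + frobSq X₂ + frobSq X₃ + frobSq X₄ := by positivity
  nlinarith [mul_le_mul_of_nonneg_right hN' hs]
end

section
/- Let N ≥ 1 and let X be an N×N complex Hermitian matrix whose operator norm satisfies ‖X‖ ≤ π (equivalently, all eigenvalues of X lie in [−π, π]). Then ‖exp(iX) − 1‖²_F ≥ (4/π²) · ‖X‖²_F, where ‖·‖_F is the Frobenius norm. -/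
open Matrix Real

/-- The operator norm of a complex `N × N` matrix: the norm of the associated continuous
linear endomorphism of Euclidean space `ℂ^N`, i.e. `‖A‖ = sup_{|v| = 1} |Av|`. -/
noncomputable def matrixOpNorm {N : ℕ} (A : Matrix (Fin N) (Fin N) ℂ) : ℝ :=
  ‖Matrix.toEuclideanCLM (𝕜 := ℂ) A‖

lemma frobSq_conj_diagonal {N : ℕ} (U : Matrix (Fin N) (Fin N) ℂ)
    (hU : star U * U = 1) (d : Fin N → ℂ) :
    frobSq (U * diagonal d * star U) = ∑ i, Complex.normSq (d i) := by
  unfold frobSq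
  have h : (U * diagonal d * star U)ᴴ * (U * diagonal d * star U)
      = U * (diagonal (star d) * diagonal d) * star U := by
    rw [conjTranspose_mul, conjTranspose_mul, diagonal_conjTranspose, ← star_eq_conjTranspose,
      ← star_eq_conjTranspose, star_star]
    calc U * (diagonal (star d) * star U) * (U * diagonal d * star U)
        = U * diagonal (star d) * (star U * U) * diagonal d * star U := by
          simp only [Matrix.mul_assoc]
      _ = _ := by rw [hU]; simp only [Matrix.mul_assoc, Matrix.one_mul]
  rw [h, trace_mul_comm, ← Matrix.mul_assoc, hU, Matrix.one_mul, diagonal_mul_diagonal,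
    trace_diagonal, Complex.re_sum]
  refine Finset.sum_congr rfl fun i _ => ?_
  simp [Complex.normSq_apply]

lemma abs_eigenvalue_le {N : ℕ} (X : Matrix (Fin N) (Fin N) ℂ) (hX : X.IsHermitian)
    (i : Fin N) : |hX.eigenvalues i| ≤ matrixOpNorm X := by
  have h := (Matrix.toEuclideanCLM (𝕜 := ℂ) X).le_opNorm (hX.eigenvectorBasis i)
  have h2 : Matrix.toEuclideanCLM (𝕜 := ℂ) X (hX.eigenvectorBasis i)
      = hX.eigenvalues i • hX.eigenvectorBasis i := by
    apply (WithLp.ofLp_injective 2)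
    have := hX.mulVec_eigenvectorBasis i
    simpa using this
  rw [h2, norm_smul, hX.eigenvectorBasis.orthonormal.1 i] at h
  simpa [matrixOpNorm] using h

lemma scalar_bound (x : ℝ) (hx : |x| ≤ π) :
    (4 / π ^ 2) * Complex.normSq (x : ℂ) ≤
      Complex.normSq (NormedSpace.exp (Complex.I * (x : ℂ)) - 1) := by
  have h := Real.cos_le_one_sub_mul_cos_sq hx
  rw [← Complex.exp_eq_exp_ℂ, mul_comm Complex.I, Complex.exp_mul_I, ← Complex.ofReal_cos,
    ← Complex.ofReal_sin]
  simp only [Complex.normSq_apply]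
  simp [-Complex.ofReal_cos, -Complex.ofReal_sin]
  have := Real.sin_sq_add_cos_sq x
  have e : 4 / π ^ 2 * (x * x) = 2 * (2 / π ^ 2 * x ^ 2) := by ring
  nlinarith

/-- for a Hermitian matrix `X` with operator norm `‖X‖ ≤ π`
(equivalently, all eigenvalues of `X` in `[−π, π]`), one has the global lower bound
`‖exp(iX) − 1‖²_F ≥ (4/π²) ‖X‖²_F`. -/
theorem single_bond_action_lower_bound (N : ℕ) (hN : 1 ≤ N)
    (X : Matrix (Fin N) (Fin N) ℂ) (hX : X.IsHermitian)
    (hXnorm : matrixOpNorm X ≤ π) :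
    frobSq (NormedSpace.exp (Complex.I • X) - 1) ≥ (4 / π ^ 2) * frobSq X := by
  set U : Matrix (Fin N) (Fin N) ℂ := (hX.eigenvectorUnitary : Matrix (Fin N) (Fin N) ℂ) with hUdef
  have hU : star U * U = 1 := Unitary.coe_star_mul_self hX.eigenvectorUnitary
  have hU' : U * star U = 1 := Unitary.coe_mul_star_self hX.eigenvectorUnitary
  set d : Fin N → ℂ := fun i => (hX.eigenvalues i : ℂ) with hd
  have hs : X = U * diagonal d * star U := by
    have := hX.spectral_theorem
    rw [Unitary.conjStarAlgAut_apply] at this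
    exact this
  have hinv : U⁻¹ = star U := Matrix.inv_eq_right_inv hU'
  have hunit : IsUnit U := ⟨⟨U, star U, hU', hU⟩, rfl⟩
  have he : NormedSpace.exp (Complex.I • X) - 1
      = U * diagonal (fun i => NormedSpace.exp (Complex.I * d i) - 1) * star U := by
    have h1 : Complex.I • X = U * diagonal (fun i => Complex.I * d i) * U⁻¹ := by
      have : diagonal (fun i => Complex.I * d i) = Complex.I • diagonal d := by
        rw [← diagonal_smul]; rfl
      rw [hinv, this, Matrix.mul_smul, Matrix.smul_mul, ← hs]
    have h2 : diagonal (fun i => NormedSpace.exp (Complex.I * d i) - 1)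
        = diagonal (NormedSpace.exp (fun i => Complex.I * d i)) - 1 := by
      rw [← diagonal_one, diagonal_sub]
      congr 1
      funext i
      rw [Pi.coe_exp]
    rw [h1, Matrix.exp_conj _ _ hunit, exp_diagonal, hinv, h2, Matrix.mul_sub, Matrix.sub_mul,
      Matrix.mul_one, hU']
  rw [he, frobSq_conj_diagonal U hU, ge_iff_le]
  have hf : frobSq X = ∑ i, Complex.normSq (d i) := by
    conv_lhs => rw [hs]
    exact frobSq_conj_diagonal U hU d
  rw [hf, Finset.mul_sum]
  exact Finset.sum_le_sum fun i _ => scalar_bound _ ((abs_eigenvalue_le X hX i).trans hXnorm)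
end

section
/- Let N ≥ 1 and let c > 0. Let L : (−π, π]^N → ℝ be a measurable function such that L(λ) ≥ c·|λ|² for all λ ∈ (−π, π]^N, and such that for every y ∈ ℝ^N, L(√β · y)/β → |y|² as β → 0⁺ (for those β > 0 with √β·y ∈ (−π, π]^N). For β > 0 define w(β) = (1/((2π)^N N!)) ∫_{(−π,π]^N} e^{−L(λ)/β} ∏_{1 ≤ j < k ≤ N} |e^{iλ_j} − e^{iλ_k}|² dλ. Then lim_{β→0⁺} w(β)/β^{N²/2} = (1/((2π)^N N!)) ∫_{ℝ^N} e^{−|y|²} ∏_{1 ≤ j < k ≤ N} (y_j − y_k)² dy. -/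
open Real Complex Filter MeasureTheory

/-- The CUE angular-eigenvalue Haar density `ρ(λ) = ∏_{j<k} |e^{iλ_j} − e^{iλ_k}|²`. -/
noncomputable def cueDensity (N : ℕ) (l : Fin N → ℝ) : ℝ :=
  ∏ p ∈ Finset.univ.filter (fun p : Fin N × Fin N => p.1 < p.2),
    ‖Complex.exp (Complex.I * (l p.1 : ℂ)) -
      Complex.exp (Complex.I * (l p.2 : ℂ))‖ ^ 2

/-- The cube `(−π, π]^N` in `ℝ^N`. -/
def cueBox (N : ℕ) : Set (Fin N → ℝ) := Set.univ.pi fun _ : Fin N => Set.Ioc (-π) π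


lemma cue_pair_norm (x y : ℝ) :
    ‖Complex.exp (Complex.I * (x : ℂ)) - Complex.exp (Complex.I * (y : ℂ))‖ ^ 2
      = (2 * Real.sin ((x - y) / 2)) ^ 2 := by
  have h : Complex.exp (Complex.I * (x : ℂ)) - Complex.exp (Complex.I * (y : ℂ))
      = Complex.exp (Complex.I * (y : ℂ)) * (Complex.exp (Complex.I * ((x - y : ℝ) : ℂ)) - 1) := by
    rw [mul_sub, ← Complex.exp_add, mul_one]
    congr 2
    push_cast
    ring
  rw [h, norm_mul, mul_comm Complex.I (y : ℂ), Complex.norm_exp_ofReal_mul_I, one_mul,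
    Complex.norm_exp_I_mul_ofReal_sub_one, Real.norm_eq_abs, sq_abs]

lemma cueDensity_eq (N : ℕ) (l : Fin N → ℝ) : cueDensity N l =
    ∏ p ∈ Finset.univ.filter (fun p : Fin N × Fin N => p.1 < p.2),
      (2 * Real.sin ((l p.1 - l p.2) / 2)) ^ 2 := by
  unfold cueDensity
  exact Finset.prod_congr rfl fun p _ => cue_pair_norm _ _

lemma cue_sin_bound (d : ℝ) : (2 * Real.sin (d / 2)) ^ 2 ≤ d ^ 2 := by
  have h := Real.abs_sin_le_abs (x := d / 2)
  have h2 := sq_le_sq.mpr h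
  nlinarith

lemma cue_sin_lim (d : ℝ) : Tendsto (fun β : ℝ => (2 * Real.sin (√β * d / 2)) ^ 2 / (√β) ^ 2)
    (nhdsWithin 0 (Set.Ioi 0)) (nhds (d ^ 2)) := by
  have hd : HasDerivAt (fun s : ℝ => 2 * Real.sin (s * d / 2)) d 0 := by
    have h1 : HasDerivAt (fun s : ℝ => s * d / 2) (1 * d / 2) 0 :=
      ((hasDerivAt_id (0 : ℝ)).mul_const d).div_const 2
    have h2 := (h1.sin).const_mul 2
    refine h2.congr_deriv ?_
    rw [zero_mul, zero_div, Real.cos_zero]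
    ring
  have h3 := hd.tendsto_slope
  have hs : Tendsto (fun β : ℝ => √β) (nhdsWithin 0 (Set.Ioi 0)) (nhdsWithin 0 {0}ᶜ) := by
    refine tendsto_nhdsWithin_iff.mpr ⟨?_, ?_⟩
    · have := (Real.continuous_sqrt.tendsto 0).mono_left (nhdsWithin_le_nhds (s := Set.Ioi 0))
      simpa using this
    · filter_upwards [self_mem_nhdsWithin] with β hβ
      exact (Real.sqrt_pos.mpr hβ).ne'
  have h4 := (h3.comp hs).pow 2
  refine h4.congr fun β => ?_
  simp [slope_def_field, div_pow]

lemma cue_card (N : ℕ) :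
    2 * (Finset.univ.filter (fun p : Fin N × Fin N => p.1 < p.2)).card + N = N ^ 2 := by
  have h1 : (Finset.univ.filter (fun p : Fin N × Fin N => p.2 < p.1)).card
      = (Finset.univ.filter (fun p : Fin N × Fin N => p.1 < p.2)).card := by
    refine Finset.card_bij (fun p _ => (p.2, p.1)) ?_ ?_ ?_
    · intro p hp; simpa using hp
    · rintro ⟨a, b⟩ _ ⟨a', b'⟩ _ h
      simp only [Prod.mk.injEq] at h ⊢
      exact ⟨h.2, h.1⟩
    · rintro ⟨a, b⟩ hp
      exact ⟨(b, a), by simpa using hp, rfl⟩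
  have h2 : (Finset.univ.filter (fun p : Fin N × Fin N => p.1 = p.2)).card = N := by
    have : (Finset.univ.filter (fun p : Fin N × Fin N => p.1 = p.2)).card
        = (Finset.univ : Finset (Fin N)).card := by
      symm
      refine Finset.card_bij (fun a _ => (a, a)) ?_ ?_ ?_
      · intro a _; simp
      · intro a _ b _ h; simpa using h
      · rintro ⟨a, b⟩ hp
        simp at hp
        exact ⟨a, Finset.mem_univ _, by simp [hp]⟩
    simpa using this
  have h3 := Finset.card_filter_add_card_filter_not (s := (Finset.univ : Finset (Fin N × Fin N)))
    (fun p => p.1 < p.2)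
  have h4 : (Finset.univ.filter (fun p : Fin N × Fin N => ¬ p.1 < p.2)).card
      = (Finset.univ.filter (fun p : Fin N × Fin N => p.2 < p.1)).card
        + (Finset.univ.filter (fun p : Fin N × Fin N => p.1 = p.2)).card := by
    rw [← Finset.card_union_of_disjoint]
    · congr 1
      ext p
      simp [le_iff_lt_or_eq, eq_comm]
    · rw [Finset.disjoint_filter]
      intro p _ h h'
      exact absurd h' h.ne'
  simp only [Finset.card_univ, Fintype.card_prod, Fintype.card_fin] at h3
  rw [pow_two]
  omega

lemma cue_gauss_integrable (N : ℕ) (c : ℝ) (hc : 0 < c) :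
    Integrable (fun y : Fin N → ℝ => Real.exp (-(c * ∑ i, y i ^ 2))) := by
  have h : (fun y : Fin N → ℝ => Real.exp (-(c * ∑ i, y i ^ 2)))
      = fun y => ∏ i, Real.exp (-c * (y i) ^ 2) := by
    funext y
    rw [← Real.exp_sum, ← Finset.mul_sum, neg_mul]
  rw [h]
  exact Integrable.fintype_prod (f := fun _ x => Real.exp (-c * x ^ 2))
    (fun _ => integrable_exp_neg_mul_sq hc)

lemma cue_bound_integrable (N : ℕ) (c : ℝ) (hc : 0 < c) :
    Integrable (fun y : Fin N → ℝ => Real.exp (-(c * ∑ i, y i ^ 2)) *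
      ∏ p ∈ Finset.univ.filter (fun p : Fin N × Fin N => p.1 < p.2), (y p.1 - y p.2) ^ 2) := by
  set M := (Finset.univ.filter (fun p : Fin N × Fin N => p.1 < p.2)).card with hM
  have hg := (cue_gauss_integrable N (c / 2) (by positivity)).const_mul
    ((8 / c) ^ M * (M.factorial : ℝ))
  refine hg.mono' (by fun_prop) (Eventually.of_forall fun y => ?_)
  have hP : 0 ≤ ∏ p ∈ Finset.univ.filter (fun p : Fin N × Fin N => p.1 < p.2),
      (y p.1 - y p.2) ^ 2 := Finset.prod_nonneg fun _ _ => sq_nonneg _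
  rw [Real.norm_of_nonneg (mul_nonneg (Real.exp_pos _).le hP)]
  set S := ∑ i, y i ^ 2 with hS
  have hS0 : 0 ≤ S := Finset.sum_nonneg fun _ _ => sq_nonneg _
  have hi : ∀ i, y i ^ 2 ≤ S := fun i =>
    Finset.single_le_sum (f := fun i => y i ^ 2) (fun _ _ => sq_nonneg _) (Finset.mem_univ i)
  have h1 : ∏ p ∈ Finset.univ.filter (fun p : Fin N × Fin N => p.1 < p.2),
      (y p.1 - y p.2) ^ 2 ≤ (4 * S) ^ M := by
    rw [hM, ← Finset.prod_const]
    refine Finset.prod_le_prod ?_ ?_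
    · intro p _; exact sq_nonneg _
    · intro p _
      nlinarith [hi p.1, hi p.2, sq_nonneg (y p.1 + y p.2)]
  have h2 := Real.pow_div_factorial_le_exp (x := c / 2 * S) (by positivity) M
  rw [div_le_iff₀ (by positivity)] at h2
  have h3 : (4 * S) ^ M = (8 / c) ^ M * (c / 2 * S) ^ M := by
    rw [← mul_pow]; congr 1; field_simp; ring
  calc _ ≤ Real.exp (-(c * S)) * ((8 / c) ^ M * (Real.exp (c / 2 * S) * M.factorial)) := by
        rw [h3] at h1
        gcongr
        exact h1.trans (by gcongr)
    _ = (8 / c) ^ M * M.factorial * (Real.exp (-(c * S)) * Real.exp (c / 2 * S)) := by ring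
    _ = _ := by rw [← Real.exp_add]; congr 2; ring

lemma cueBox_measurable (N : ℕ) : MeasurableSet (cueBox N) :=
  MeasurableSet.univ_pi fun _ => measurableSet_Ioc

lemma cueBox_eventually (N : ℕ) (y : Fin N → ℝ) :
    ∀ᶠ β in nhdsWithin (0 : ℝ) (Set.Ioi 0), √β • y ∈ cueBox N := by
  have hc : Tendsto (fun β : ℝ => √β • y) (nhdsWithin 0 (Set.Ioi 0)) (nhds 0) := by
    have : Continuous (fun β : ℝ => √β • y) := by fun_prop
    have := (this.tendsto 0).mono_left (nhdsWithin_le_nhds (s := Set.Ioi 0))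
    simpa using this
  refine hc.eventually ?_
  have : cueBox N ∈ nhds (0 : Fin N → ℝ) :=
    set_pi_mem_nhds Set.finite_univ fun i _ =>
      Ioc_mem_nhds (by simpa using Real.pi_pos) (by simpa using Real.pi_pos)
  exact this

/-- The rescaled integrand. -/
noncomputable def cueResc (N : ℕ) (L : (Fin N → ℝ) → ℝ) (β : ℝ) (y : Fin N → ℝ) : ℝ :=
  (cueBox N).indicator (fun l => Real.exp (-(L l) / β)) (√β • y) *
    ∏ p ∈ Finset.univ.filter (fun p : Fin N × Fin N => p.1 < p.2),
      ((2 * Real.sin (√β * (y p.1 - y p.2) / 2)) ^ 2 / (√β) ^ 2)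

lemma cue_rescale (N : ℕ) (L : (Fin N → ℝ) → ℝ) (β : ℝ) (hβ : 0 < β) :
    (∫ l in cueBox N, Real.exp (-(L l) / β) * cueDensity N l) / β ^ ((N ^ 2 : ℝ) / 2)
      = ∫ y, cueResc N L β y := by
  have hs : 0 < √β := Real.sqrt_pos.mpr hβ
  set M := (Finset.univ.filter (fun p : Fin N × Fin N => p.1 < p.2)).card with hM
  have hpow : β ^ ((N ^ 2 : ℝ) / 2) = (√β) ^ N * ((√β) ^ 2) ^ M := by
    rw [← pow_mul, ← pow_add, show N + 2 * M = N ^ 2 by have := cue_card N; omega,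
      Real.sqrt_eq_rpow, ← Real.rpow_mul_natCast hβ.le]
    congr 1
    push_cast
    ring
  have h := Measure.integral_comp_smul (volume : Measure (Fin N → ℝ))
    ((cueBox N).indicator fun l => Real.exp (-(L l) / β) * cueDensity N l) (√β)
  rw [integral_indicator (cueBox_measurable N)] at h
  have hp : ∀ y, cueResc N L β y = ((cueBox N).indicator
      (fun l => Real.exp (-(L l) / β) * cueDensity N l) (√β • y)) / ((√β) ^ 2) ^ M := by
    intro y
    unfold cueResc
    rw [Finset.prod_div_distrib, Finset.prod_const, ← hM, ← mul_div_assoc]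
    congr 1
    by_cases hy : √β • y ∈ cueBox N
    · rw [Set.indicator_of_mem hy, Set.indicator_of_mem hy, cueDensity_eq]
      congr 1
      refine Finset.prod_congr rfl fun p _ => ?_
      simp [mul_sub]
    · rw [Set.indicator_of_notMem hy, Set.indicator_of_notMem hy, zero_mul]
  simp_rw [hp]
  rw [integral_div, h, hpow, Module.finrank_fin_fun, abs_of_pos (by positivity), smul_eq_mul]
  field_simp

/-- the paper's Theorem 4, CUE-to-GUE limit: if the measurable function
`L : (−π,π]^N → ℝ` satisfies `L(λ) ≥ c|λ|²` on the box and `L(√β·y)/β → |y|²` as `β → 0⁺`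
(through those `β > 0` with `√β·y` in the box), then for
`w(β) = (1/((2π)^N N!)) ∫_{(−π,π]^N} e^{−L(λ)/β} ρ(λ) dλ` one has
`w(β)/β^{N²/2} → (1/((2π)^N N!)) ∫_{ℝ^N} e^{−|y|²} ∏_{j<k}(y_j − y_k)² dy` as `β → 0⁺`. -/
theorem cue_to_gue_limit (N : ℕ) (hN : 1 ≤ N) (c : ℝ) (hc : 0 < c)
    (L : (Fin N → ℝ) → ℝ) (hLmeas : Measurable L)
    (hLlow : ∀ l ∈ cueBox N, c * (∑ i, l i ^ 2) ≤ L l)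
    (hLlim : ∀ y : Fin N → ℝ,
      Tendsto (fun β : ℝ => L (Real.sqrt β • y) / β)
        (nhdsWithin 0 {β : ℝ | 0 < β ∧ Real.sqrt β • y ∈ cueBox N})
        (nhds (∑ i, y i ^ 2))) :
    Tendsto
      (fun β : ℝ =>
        ((1 : ℝ) / ((2 * π) ^ N * (Nat.factorial N)) *
            ∫ l in cueBox N, Real.exp (-(L l) / β) * cueDensity N l) /
          β ^ ((N ^ 2 : ℝ) / 2))
      (nhdsWithin 0 (Set.Ioi 0))
      (nhds ((1 : ℝ) / ((2 * π) ^ N * (Nat.factorial N)) *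
        ∫ y : Fin N → ℝ, Real.exp (-(∑ i, y i ^ 2)) *
          ∏ p ∈ Finset.univ.filter (fun p : Fin N × Fin N => p.1 < p.2),
            (y p.1 - y p.2) ^ 2)) := by
  have key : Tendsto (fun β : ℝ => ∫ y, cueResc N L β y) (nhdsWithin 0 (Set.Ioi 0))
      (nhds (∫ y : Fin N → ℝ, Real.exp (-(∑ i, y i ^ 2)) *
          ∏ p ∈ Finset.univ.filter (fun p : Fin N × Fin N => p.1 < p.2),
            (y p.1 - y p.2) ^ 2)) := by
    refine tendsto_integral_filter_of_dominated_convergence _ ?_ ?_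
      (cue_bound_integrable N c hc) ?_
    · refine Eventually.of_forall fun β => Measurable.aestronglyMeasurable ?_
      unfold cueResc
      refine Measurable.mul ?_ (by fun_prop)
      have h1 : Measurable ((cueBox N).indicator (fun l => Real.exp (-(L l) / β))) :=
        Measurable.indicator (by fun_prop) (cueBox_measurable N)
      exact h1.comp (by fun_prop)
    · filter_upwards [self_mem_nhdsWithin] with β hβ
      have hβ' : 0 < β := hβ
      have hs : 0 < √β := Real.sqrt_pos.mpr hβ'
      refine Eventually.of_forall fun y => ?_
      unfold cueResc
      have hi0 : 0 ≤ (cueBox N).indicator (fun l => Real.exp (-(L l) / β)) (√β • y) :=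
        Set.indicator_nonneg (fun _ _ => (Real.exp_pos _).le) _
      rw [Real.norm_of_nonneg (mul_nonneg hi0 (Finset.prod_nonneg fun _ _ => by positivity))]
      refine mul_le_mul ?_ ?_ (Finset.prod_nonneg fun _ _ => by positivity) (Real.exp_pos _).le
      · by_cases hy : √β • y ∈ cueBox N
        · rw [Set.indicator_of_mem hy]
          refine Real.exp_le_exp.mpr ?_
          have h := hLlow _ hy
          have h2 : ∑ i, (√β • y) i ^ 2 = β * ∑ i, y i ^ 2 := by
            simp [mul_pow, Real.sq_sqrt hβ'.le, Finset.mul_sum]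
          rw [h2] at h
          rw [neg_div, neg_le_neg_iff, le_div_iff₀ hβ']
          linarith
        · rw [Set.indicator_of_notMem hy]
          exact (Real.exp_pos _).le
      · refine Finset.prod_le_prod (fun _ _ => by positivity) fun p _ => ?_
        rw [div_le_iff₀ (by positivity), ← mul_pow, mul_comm (y p.1 - y p.2)]
        exact cue_sin_bound _
    · refine Eventually.of_forall fun y => ?_
      unfold cueResc
      have hev := cueBox_eventually N y
      refine Tendsto.mul ?_ (tendsto_finsetProd _ fun p _ => cue_sin_lim _)
      have hle : nhdsWithin (0 : ℝ) (Set.Ioi 0) ≤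
          nhdsWithin 0 {β : ℝ | 0 < β ∧ Real.sqrt β • y ∈ cueBox N} := by
        rw [nhdsWithin_le_iff]
        filter_upwards [self_mem_nhdsWithin, hev] with β h1 h2
        exact ⟨h1, h2⟩
      have h := (Real.continuous_exp.tendsto _).comp ((hLlim y).mono_left hle).neg
      refine h.congr' ?_
      filter_upwards [hev] with β hy
      rw [Set.indicator_of_mem hy]
      simp [neg_div]
  refine (key.const_mul _).congr' ?_
  filter_upwards [self_mem_nhdsWithin] with β hβ
  rw [← cue_rescale N L β hβ, mul_div_assoc]
end

section
/- Let N ≥ 1, let g be an N×N real orthogonal matrix, and let c be a real number with |c| ≤ 1/2. Define the integral operator T on L²(ℝ^N) by (Tf)(x) = ∫_{ℝ^N} e^{−|x|²/4} e^{c⟨x, g y⟩} e^{−|y|²/4} f(y) dy. Then T is a bounded operator and its operator norm satisfies ‖T‖ ≤ (4π)^{N/2}, i.e. ‖Tf‖_{L²} ≤ (4π)^{N/2}·‖f‖_{L²} for every f ∈ L²(ℝ^N). -/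
open Real MeasureTheory Matrix

/-- Holmgren / Schur test, squared form. -/
theorem holmgren_aux {α : Type*} [MeasurableSpace α] (μ : Measure α) [SFinite μ]
    (K : α → α → ENNReal) (hK : Measurable (Function.uncurry K)) (C : ENNReal)
    (h1 : ∀ x, ∫⁻ y, K x y ∂μ ≤ C) (h2 : ∀ y, ∫⁻ x, K x y ∂μ ≤ C)
    (F : α → ENNReal) (hF : Measurable F) :
    ∫⁻ x, (∫⁻ y, K x y * F y ∂μ) ^ (2 : ℝ) ∂μ ≤ C ^ (2 : ℝ) * ∫⁻ y, F y ^ (2 : ℝ) ∂μ := by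
  have hKx : ∀ x, Measurable (K x) := fun x => hK.comp measurable_prodMk_left
  have hKy : ∀ y, Measurable (fun x => K x y) := fun x => hK.comp measurable_prodMk_right
  have step : ∀ x, (∫⁻ y, K x y * F y ∂μ) ^ (2 : ℝ) ≤ C * ∫⁻ y, K x y * F y ^ (2 : ℝ) ∂μ := by
    intro x
    have hs : ∀ a : ENNReal, (a ^ (1 / 2 : ℝ)) ^ (2 : ℝ) = a := by
      intro a
      rw [← ENNReal.rpow_mul]; norm_num
    have hh : ∀ a : ENNReal, a ^ (1 / 2 : ℝ) * a ^ (1 / 2 : ℝ) = a := by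
      intro a
      have := hs a
      rwa [ENNReal.rpow_two, sq] at this
    have hpq : (2 : ℝ).HolderConjugate 2 := Real.HolderConjugate.two_two
    have cs := ENNReal.lintegral_mul_le_Lp_mul_Lq μ hpq
      (f := fun y => K x y ^ (1 / 2 : ℝ)) (g := fun y => K x y ^ (1 / 2 : ℝ) * F y)
      ((hKx x).pow_const _).aemeasurable (((hKx x).pow_const _).mul hF).aemeasurable
    simp only [Pi.mul_apply, ← mul_assoc, hh, hs,
      ENNReal.mul_rpow_of_nonneg _ _ (zero_le_two : (0 : ℝ) ≤ 2)] at cs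
    calc (∫⁻ y, K x y * F y ∂μ) ^ (2 : ℝ) ≤ _ := ENNReal.rpow_le_rpow cs zero_le_two
      _ = (∫⁻ y, K x y ∂μ) * ∫⁻ y, K x y * F y ^ (2 : ℝ) ∂μ := by
        rw [ENNReal.mul_rpow_of_nonneg _ _ (zero_le_two : (0 : ℝ) ≤ 2), hs, hs]
      _ ≤ _ := by gcongr; exact h1 x
  have hm : Measurable (Function.uncurry fun x y => K x y * F y ^ (2 : ℝ)) :=
    hK.mul ((hF.comp measurable_snd).pow_const _)
  calc ∫⁻ x, (∫⁻ y, K x y * F y ∂μ) ^ (2 : ℝ) ∂μ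
      ≤ ∫⁻ x, C * ∫⁻ y, K x y * F y ^ (2 : ℝ) ∂μ ∂μ := lintegral_mono step
    _ = C * ∫⁻ x, ∫⁻ y, K x y * F y ^ (2 : ℝ) ∂μ ∂μ :=
        lintegral_const_mul _ hm.lintegral_prod_right
    _ = C * ∫⁻ y, ∫⁻ x, K x y * F y ^ (2 : ℝ) ∂μ ∂μ := by
        rw [lintegral_lintegral_swap hm.aemeasurable]
    _ = C * ∫⁻ y, (∫⁻ x, K x y ∂μ) * F y ^ (2 : ℝ) ∂μ := by
        congr 1
        exact lintegral_congr fun y => lintegral_mul_const _ (hKy y)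
    _ ≤ C * ∫⁻ y, C * F y ^ (2 : ℝ) ∂μ := by
        gcongr with y; exact h2 y
    _ = _ := by
        rw [lintegral_const_mul _ (hF.pow_const _), ← mul_assoc, ENNReal.rpow_two, sq]

theorem gauss_aux (N : ℕ) (w : Fin N → ℝ) :
    ∫⁻ y : Fin N → ℝ, ENNReal.ofReal (Real.exp (-(∑ i, y i ^ 2) / 4 + ∑ i, w i * y i))
      = ENNReal.ofReal ((4 * π) ^ ((N : ℝ) / 2) * Real.exp (∑ i, w i ^ 2)) := by
  have hb : 0 < ((1 / 4 : ℝ) : ℂ).re := by rw [Complex.ofReal_re]; norm_num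
  have key : ∀ y : Fin N → ℝ, Complex.exp (-((1 / 4 : ℝ) : ℂ) * ∑ i, (y i : ℂ) ^ 2
      + ∑ i, (w i : ℂ) * y i)
      = ((Real.exp (-(∑ i, y i ^ 2) / 4 + ∑ i, w i * y i) : ℝ) : ℂ) := by
    intro y
    push_cast
    congr 1
    ring
  have hint := GaussianFourier.integrable_cexp_neg_mul_sum_add hb (fun i => (w i : ℂ))
  have hval := GaussianFourier.integral_cexp_neg_mul_sum_add hb (fun i => (w i : ℂ))
  simp only [key] at hint hval
  have hint' : Integrable (fun y : Fin N → ℝ =>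
      Real.exp (-(∑ i, y i ^ 2) / 4 + ∑ i, w i * y i)) := by
    exact hint.re
  rw [← ofReal_integral_eq_lintegral_ofReal hint' (Filter.Eventually.of_forall fun y => (Real.exp_pos _).le)]
  congr 1
  rw [integral_complex_ofReal] at hval
  apply Complex.ofReal_injective
  rw [hval]
  push_cast
  rw [Complex.ofReal_cpow (by positivity)]
  push_cast
  congr 2
  · ring
  · simp
  · ring

/-- single-bond transfer matrix bound: for orthogonal `g` and `|c| ≤ 1/2`,
the integral operator on `L²(ℝ^N)` with kernel
`T(x,y) = e^{−|x|²/4} e^{c⟨x, gy⟩} e^{−|y|²/4}` is bounded with operator norm at most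
`(4π)^{N/2}`: for every `f ∈ L²`, `Tf ∈ L²` and `‖Tf‖_{L²} ≤ (4π)^{N/2} ‖f‖_{L²}`. -/
theorem transfer_matrix_opNorm_bound (N : ℕ) (hN : 1 ≤ N)
    (g : Matrix (Fin N) (Fin N) ℝ) (hg : g ∈ Matrix.orthogonalGroup (Fin N) ℝ)
    (c : ℝ) (hc : |c| ≤ 1 / 2)
    (f : (Fin N → ℝ) → ℝ) (hf : MemLp f 2 (volume : Measure (Fin N → ℝ))) :
    MemLp
      (fun x : Fin N → ℝ => ∫ y : Fin N → ℝ,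
        Real.exp (-(∑ i, x i ^ 2) / 4) * Real.exp (c * ∑ i, x i * g.mulVec y i) *
          Real.exp (-(∑ i, y i ^ 2) / 4) * f y)
      2 (volume : Measure (Fin N → ℝ)) ∧
    eLpNorm
      (fun x : Fin N → ℝ => ∫ y : Fin N → ℝ,
        Real.exp (-(∑ i, x i ^ 2) / 4) * Real.exp (c * ∑ i, x i * g.mulVec y i) *
          Real.exp (-(∑ i, y i ^ 2) / 4) * f y)
      2 (volume : Measure (Fin N → ℝ))
      ≤ ENNReal.ofReal ((4 * π) ^ ((N : ℝ) / 2)) *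
          eLpNorm f 2 (volume : Measure (Fin N → ℝ)) := by
  have hc2 : c ^ 2 ≤ 1 / 4 := by
    have := abs_le.1 hc
    nlinarith
  set C : ENNReal := ENNReal.ofReal ((4 * π) ^ ((N : ℝ) / 2)) with hC
  obtain ⟨f', hf'm, hff'⟩ := hf.1
  set k : (Fin N → ℝ) → (Fin N → ℝ) → ℝ := fun x y =>
    Real.exp (-(∑ i, x i ^ 2) / 4) * Real.exp (c * ∑ i, x i * g.mulVec y i) *
          Real.exp (-(∑ i, y i ^ 2) / 4) with hk
  have hkpos : ∀ x y, 0 ≤ k x y := fun x y => by simp only [hk]; positivity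
  have hkc : Continuous (Function.uncurry k) := by
    simp only [hk, Function.uncurry_def, Matrix.mulVec, dotProduct]
    fun_prop
  have hfun : (fun x : Fin N → ℝ => ∫ y : Fin N → ℝ,
        Real.exp (-(∑ i, x i ^ 2) / 4) * Real.exp (c * ∑ i, x i * g.mulVec y i) *
          Real.exp (-(∑ i, y i ^ 2) / 4) * f y) = fun x => ∫ y, k x y * f' y := by
    funext x
    apply integral_congr_ae
    filter_upwards [hff'] with y hy
    simp only [hk, hy]
  rw [hfun, eLpNorm_congr_ae hff']
  have hf' : MemLp f' 2 volume := (memLp_congr_ae hff').1 hf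
  have bound : ∀ (x w : Fin N → ℝ), (∑ i, w i ^ 2 = c ^ 2 * ∑ i, x i ^ 2) →
      ∫⁻ y : Fin N → ℝ, ENNReal.ofReal (Real.exp (-(∑ i, x i ^ 2) / 4) *
        Real.exp (-(∑ i, y i ^ 2) / 4 + ∑ i, w i * y i)) ≤ C := by
    intro x w hw
    simp only [ENNReal.ofReal_mul (Real.exp_pos _).le]
    rw [lintegral_const_mul _ (by fun_prop), gauss_aux, hw,
      ← ENNReal.ofReal_mul (Real.exp_pos _).le, hC]
    apply ENNReal.ofReal_le_ofReal
    rw [mul_left_comm, ← Real.exp_add]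
    apply mul_le_of_le_one_right (by positivity)
    rw [Real.exp_le_one_iff]
    have : 0 ≤ ∑ i, x i ^ 2 := Finset.sum_nonneg fun i _ => sq_nonneg _
    nlinarith
  have dsq : ∀ v : Fin N → ℝ, ∑ i, (c * v i) ^ 2 = c ^ 2 * (v ⬝ᵥ v) := by
    intro v
    simp only [dotProduct, Finset.mul_sum]
    exact Finset.sum_congr rfl fun i _ => by ring
  have dsq' : ∀ v : Fin N → ℝ, v ⬝ᵥ v = ∑ i, v i ^ 2 := by
    intro v
    simp only [dotProduct]
    exact Finset.sum_congr rfl fun i _ => by ring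
  have hg1 : g * gᵀ = 1 := by
    simpa [Matrix.star_eq_conjTranspose] using (Matrix.mem_orthogonalGroup_iff (Fin N) ℝ).1 hg
  have hg2 : gᵀ * g = 1 := by
    simpa [Matrix.star_eq_conjTranspose] using (Matrix.mem_orthogonalGroup_iff' (Fin N) ℝ).1 hg
  have hrow : ∀ x, ∫⁻ y, ENNReal.ofReal (k x y) ≤ C := by
    intro x
    refine le_of_eq_of_le ?_ (bound x (fun i => c * (x ᵥ* g) i) ?_)
    · refine lintegral_congr fun y => ?_
      congr 1
      simp only [hk]
      rw [mul_assoc, ← Real.exp_add, add_comm]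
      congr 3
      have : ∑ i, x i * (g *ᵥ y) i = ∑ i, (x ᵥ* g) i * y i := Matrix.dotProduct_mulVec x g y
      rw [this, Finset.mul_sum]
      exact Finset.sum_congr rfl fun i _ => by ring
    · rw [dsq, ← dsq']
      congr 1
      rw [← Matrix.dotProduct_mulVec, ← Matrix.mulVec_transpose, Matrix.mulVec_mulVec, hg1,
        Matrix.one_mulVec]
  have hcol : ∀ y, ∫⁻ x, ENNReal.ofReal (k x y) ≤ C := by
    intro y
    refine le_of_eq_of_le ?_ (bound y (fun i => c * (g *ᵥ y) i) ?_)
    · refine lintegral_congr fun x => ?_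
      congr 1
      simp only [hk]
      rw [mul_comm, ← Real.exp_add]
      congr 3
      rw [Finset.mul_sum]
      exact Finset.sum_congr rfl fun i _ => by ring
    · rw [dsq, ← dsq']
      congr 1
      rw [Matrix.dotProduct_mulVec, ← Matrix.mulVec_transpose, Matrix.mulVec_mulVec, hg2,
        Matrix.one_mulVec]
  have hol := holmgren_aux (volume : Measure (Fin N → ℝ)) (fun x y => ENNReal.ofReal (k x y))
    (hkc.measurable.ennreal_ofReal) C hrow hcol (fun y => ‖f' y‖ₑ) hf'm.enorm
  have hmain : eLpNorm (fun x => ∫ y, k x y * f' y) 2 volume ≤ C * eLpNorm f' 2 volume := by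
    rw [eLpNorm_eq_lintegral_rpow_enorm_toReal two_ne_zero ENNReal.ofNat_ne_top,
      eLpNorm_eq_lintegral_rpow_enorm_toReal two_ne_zero ENNReal.ofNat_ne_top]
    simp only [ENNReal.toReal_ofNat]
    have h3 : ∫⁻ x, ‖∫ y, k x y * f' y‖ₑ ^ (2 : ℝ) ≤ C ^ (2 : ℝ) * ∫⁻ y, ‖f' y‖ₑ ^ (2 : ℝ) := by
      refine le_trans (lintegral_mono fun x => ?_) hol
      refine ENNReal.rpow_le_rpow ?_ zero_le_two
      refine (enorm_integral_le_lintegral_enorm _).trans (le_of_eq ?_)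
      refine lintegral_congr fun y => ?_
      rw [enorm_mul, Real.enorm_of_nonneg (hkpos x y)]
    refine (ENNReal.rpow_le_rpow h3 (by norm_num)).trans (le_of_eq ?_)
    rw [ENNReal.mul_rpow_of_nonneg _ _ (by norm_num), ← ENNReal.rpow_mul]
    norm_num
  refine ⟨⟨?_, ?_⟩, hmain⟩
  · have : StronglyMeasurable (Function.uncurry fun x y => k x y * f' y) :=
      hkc.stronglyMeasurable.mul (hf'm.comp_measurable measurable_snd)
    exact this.integral_prod_right.aestronglyMeasurable
  · exact hmain.trans_lt (ENNReal.mul_lt_top ENNReal.ofReal_lt_top hf'.2)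
end
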